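/- arXiv:1912.08551 — 3 statements merged into one kernel-verified Lean document; each statement's English description precedes it below -/
import Mathlib

section
/- For any n ≥ k ≥ 1, writing n = dk + r with 0 ≤ r < k, the generating function of the width-k type-B descent statistic over the hyperoctahedral group satisfies Σ_{π ∈ B_n} x^{des_k^B(π)} = 2^{n-d} · M_{n,k} · B_d(x) · A_d(x)^{k-r-1} · A_{d+1}(x)^r, where M_{n,k} = n!/((d+1)!^r d!^{k-r}), B_d(x) = Σ_{π ∈ B_d} x^{des^B(π)}, and A_m(x) is the classical Eulerian polynomial. -/
open Finset

/-- The value function of the signed permutation determined by `σ` and sign vector `ε`: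
`bval n σ ε i` is `π(i)` for `i ∈ {-n,…,n}`, with `π(0) = 0` and `π(-i) = -π(i)`. -/
def bval (n : ℕ) (σ : Equiv.Perm (Fin n)) (ε : Fin n → Bool) : ℤ → ℤ := fun i =>
  if h : 1 ≤ i.natAbs ∧ i.natAbs ≤ n then
    (Int.sign i) *
      (if ε ⟨i.natAbs - 1, by omega⟩ then -((((σ ⟨i.natAbs - 1, by omega⟩ : Fin n) : ℕ) : ℤ) + 1)
       else (((σ ⟨i.natAbs - 1, by omega⟩ : Fin n) : ℕ) : ℤ) + 1)
  else 0

/-- width-`k` type-B descent number: `#{0 ≤ i ≤ n-k : π(i) > π(i+k)}`, `π(0)=0`. -/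
def desB (n k : ℕ) (π : ℤ → ℤ) : ℕ :=
  ((range (n - k + 1)).filter fun i : ℕ => π i > π ((i : ℤ) + k)).card

/-- width-`k` type-A descent number: `#{1 ≤ i ≤ n-k : π(i) > π(i+k)}`. -/
def desA (n k : ℕ) (π : ℤ → ℤ) : ℕ :=
  ((Icc 1 (n - k)).filter fun i : ℕ => π i > π ((i : ℤ) + k)).card

/-- width-`k` negative descent number: `#{1 ≤ i ≤ n-k : π(-i) > π(i+k)}`. -/
def ndesB (n k : ℕ) (π : ℤ → ℤ) : ℕ :=
  ((Icc 1 (n - k)).filter fun i : ℕ => π (-(i : ℤ)) > π ((i : ℤ) + k)).card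

/-- width-`k` inversion number: pairs `i < j` in `[n]` with `j - i` a positive multiple of `k`
and `π(i) > π(j)`. -/
def invAk (n k : ℕ) (π : ℤ → ℤ) : ℕ :=
  (((Icc 1 n) ×ˢ (Icc 1 n)).filter fun p : ℕ × ℕ =>
    p.1 < p.2 ∧ k ∣ (p.2 - p.1) ∧ π p.1 > π p.2).card

/-- width-`k` negative-entry statistic: `#{1 ≤ i ≤ ⌊n/k⌋ : π(ik) < 0}`. -/
def negk (n k : ℕ) (π : ℤ → ℤ) : ℕ :=
  ((Icc 1 (n / k)).filter fun i : ℕ => π ((i : ℤ) * k) < 0).card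

/-- width-`k` negative-sum-pair statistic. -/
def nspk (n k : ℕ) (π : ℤ → ℤ) : ℕ :=
  (((Icc 1 n) ×ˢ (Icc 1 n)).filter fun p : ℕ × ℕ =>
    p.1 < p.2 ∧ k ∣ (p.2 - p.1) ∧ π p.1 + π p.2 < 0).card

/-- width-`k` type-B inversion number. -/
def invBk (n k : ℕ) (π : ℤ → ℤ) : ℕ := invAk n k π + negk n k π + nspk n k π

/-- The classical Eulerian polynomial `A_m(x) = Σ_{σ ∈ S_m} x^{des^A(σ)}`, evaluated at `x`. -/
def EulA {R : Type*} [CommRing R] (m : ℕ) (x : R) : R :=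
  ∑ σ : Equiv.Perm (Fin m), x ^ desA m 1 (bval m σ fun _ => false)

/-- The type-B Eulerian polynomial `B_m(x) = Σ_{π ∈ B_m} x^{des^B(π)}`, evaluated at `x`. -/
def EulB {R : Type*} [CommRing R] (m : ℕ) (x : R) : R :=
  ∑ σ : Equiv.Perm (Fin m), ∑ ε : Fin m → Bool, x ^ desB m 1 (bval m σ ε)

/-- The multinomial coefficient `M_{n,k} = n! / ((d+1)!^r d!^{k-r})` where `n = dk + r`. -/
def Mnk (n k : ℕ) : ℕ :=
  n.factorial / ((n / k + 1).factorial ^ (n % k) * (n / k).factorial ^ (k - n % k))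


/-- Extend a function on `Fin m` by zero. -/
def extZ {m : ℕ} (u : Fin m → ℤ) : ℕ → ℤ := fun i => if h : i < m then u ⟨i, h⟩ else 0

/-- signed value -/
def sg (b : Bool) (a : ℤ) : ℤ := if b then -a else a

/-- descents of a finite sequence -/
def cls (m : ℕ) (u : ℕ → ℤ) : ℕ := ((range (m - 1)).filter fun i => u i > u (i + 1)).card

/-- the indicator of a negative value -/
def ng (a : ℤ) : ℕ := if a < 0 then 1 else 0

theorem bval_eq (n : ℕ) (σ : Equiv.Perm (Fin n)) (ε : Fin n → Bool) (p : ℕ) (i : ℤ)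
    (hi : i = (p : ℤ) + 1) :
    bval n σ ε i = extZ (fun q => sg (ε q) ((σ q : ℕ) + 1)) p := by
  subst hi
  have h1 : ((p : ℤ) + 1).natAbs = p + 1 := by omega
  have h2 : ((p : ℤ) + 1).sign = 1 := Int.sign_eq_one_of_pos (by omega)
  unfold bval extZ sg
  by_cases h : p < n
  · rw [dif_pos (by omega), dif_pos h, h2]
    simp [h1]
  · rw [dif_neg (by omega), dif_neg h]

theorem bval_zero (n : ℕ) (σ : Equiv.Perm (Fin n)) (ε : Fin n → Bool) :
    bval n σ ε 0 = 0 := by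
  simp [bval]

theorem desB_eq (n k : ℕ) (hk : 1 ≤ k) (σ : Equiv.Perm (Fin n)) (ε : Fin n → Bool) :
    desB n k (bval n σ ε) =
      (∑ p ∈ range (n - k), if extZ (fun q => sg (ε q) ((σ q : ℕ) + 1)) p >
        extZ (fun q => sg (ε q) ((σ q : ℕ) + 1)) (p + k) then 1 else 0) +
      ng (extZ (fun q => sg (ε q) ((σ q : ℕ) + 1)) (k - 1)) := by
  unfold desB
  rw [card_filter, sum_range_succ']
  congr 1
  · apply sum_congr rfl
    intro p hp
    rw [bval_eq n σ ε p _ (by push_cast; ring), bval_eq n σ ε (p + k) _ (by push_cast; ring)]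
  · rw [bval_eq n σ ε (k - 1) (((0 : ℕ) : ℤ) + k) (by omega), Nat.cast_zero, bval_zero]
    rfl

theorem desB_one (n : ℕ) (σ : Equiv.Perm (Fin n)) (ε : Fin n → Bool) :
    desB n 1 (bval n σ ε) =
      cls n (extZ (fun q => sg (ε q) ((σ q : ℕ) + 1))) +
      ng (extZ (fun q => sg (ε q) ((σ q : ℕ) + 1)) 0) := by
  rw [desB_eq n 1 le_rfl, cls, card_filter]

theorem desA_one (n : ℕ) (σ : Equiv.Perm (Fin n)) :
    desA n 1 (bval n σ fun _ => false) =
      cls n (extZ (fun q => ((σ q : ℕ) : ℤ) + 1)) := by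
  unfold desA cls
  rw [card_filter, card_filter, range_eq_Ico, ← Finset.Ico_add_one_right_eq_Icc,
    ← Finset.sum_Ico_add' _ 0 (n - 1) 1]
  apply sum_congr rfl
  intro p hp
  rw [bval_eq n σ _ p _ (by push_cast; ring), bval_eq n σ _ (p + 1) _ (by push_cast; ring)]
  simp [sg]

theorem cls_congr {m : ℕ} {u v : Fin m → ℤ} (h : ∀ i j, u i > u j ↔ v i > v j) :
    cls m (extZ u) = cls m (extZ v) := by
  unfold cls
  congr 1
  apply filter_congr
  intro i hi
  rw [mem_range] at hi
  unfold extZ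
  rw [dif_pos (by omega), dif_pos (by omega), dif_pos (by omega), dif_pos (by omega)]
  exact h _ _

theorem ng_congr {m : ℕ} {u v : Fin m → ℤ} (h : ∀ i, u i < 0 ↔ v i < 0) :
    ng (extZ u 0) = ng (extZ v 0) := by
  unfold ng extZ
  by_cases hm : 0 < m
  · simp [hm, h]
  · simp [hm]

theorem strict_sort {m : ℕ} (g : Fin m → ℤ) (hg : Function.Injective g) :
    StrictMono (g ∘ Tuple.sort g) :=
  (Tuple.monotone_sort g).strictMono_of_injective (hg.comp (Tuple.sort g).injective)

theorem lemA {R : Type*} [CommRing R] (x : R) {m : ℕ} (g : Fin m → ℤ)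
    (hg : Function.Injective g) :
    ∑ h : Equiv.Perm (Fin m), x ^ cls m (extZ (fun i => g (h i))) = EulA m x := by
  unfold EulA
  rw [← Equiv.sum_comp (Equiv.mulLeft (Tuple.sort g))]
  apply sum_congr rfl
  intro h _
  rw [desA_one]
  congr 1
  apply cls_congr
  intro i j
  have := (strict_sort g hg).lt_iff_lt (a := h j) (b := h i)
  simp only [Function.comp] at this
  simp [this]

theorem lemA2 {R : Type*} [CommRing R] (x : R) {m : ℕ} (g : Fin m → ℤ)
    (hg : Function.Injective g) (hp : ∀ i, 0 < g i) :
    ∑ h : Equiv.Perm (Fin m), ∑ δ : Fin m → Bool,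
      x ^ cls m (extZ (fun i => sg (δ i) (g (h i)))) = 2 ^ m * EulA m x := by
  have : ∀ h : Equiv.Perm (Fin m), ∑ δ : Fin m → Bool,
      x ^ cls m (extZ (fun i => sg (δ i) (g (h i)))) =
      ∑ δ : Fin m → Bool, x ^ cls m (extZ (fun i => sg (δ (h i)) (g (h i)))) := by
    intro h
    rw [← (Equiv.arrowCongr h.symm (Equiv.refl Bool)).sum_comp]
    rfl
  simp_rw [this]
  rw [sum_comm]
  have : ∀ δ : Fin m → Bool, ∑ h : Equiv.Perm (Fin m),
      x ^ cls m (extZ (fun i => sg (δ (h i)) (g (h i)))) = EulA m x := by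
    intro δ
    apply lemA x (fun i => sg (δ i) (g i))
    intro a b hab
    apply hg
    have := hp a
    have := hp b
    simp only [sg] at hab
    split_ifs at hab <;> omega
  simp [this]

theorem lemB {R : Type*} [CommRing R] (x : R) {m : ℕ} (g : Fin m → ℤ)
    (hg : Function.Injective g) (hp : ∀ i, 0 < g i) :
    ∑ h : Equiv.Perm (Fin m), ∑ δ : Fin m → Bool,
      x ^ (cls m (extZ (fun i => sg (δ i) (g (h i)))) +
        ng (extZ (fun i => sg (δ i) (g (h i))) 0)) = EulB m x := by
  unfold EulB
  rw [← Equiv.sum_comp (Equiv.mulLeft (Tuple.sort g))]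
  apply sum_congr rfl
  intro h _
  apply sum_congr rfl
  intro δ _
  rw [desB_one]
  congr 2
  · apply cls_congr
    intro i j
    have h1 := (strict_sort g hg).lt_iff_lt (a := h j) (b := h i)
    have h2 := (strict_sort g hg).lt_iff_lt (a := h i) (b := h j)
    simp only [Function.comp, Fin.lt_def] at h1 h2
    have := hp (Tuple.sort g (h i))
    have := hp (Tuple.sort g (h j))
    simp only [sg, Equiv.coe_mulLeft, Equiv.Perm.mul_apply]
    split_ifs <;> omega
  · apply ng_congr
    intro i
    have := hp (Tuple.sort g (h i))
    simp only [sg, Equiv.coe_mulLeft, Equiv.Perm.mul_apply]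
    split_ifs <;> omega

/-- sizes of the residue classes -/
def sz (n k j : ℕ) : ℕ := if j < n % k then n / k + 1 else n / k

theorem lt_sz (n k j i : ℕ) (hj : j < k) : i < sz n k j ↔ j + k * i < n := by
  have h1 := Nat.div_add_mod n k
  have h2 := Nat.mod_lt n (by omega : k > 0)
  unfold sz
  generalize n / k = d at *
  generalize n % k = r at *
  subst h1
  split_ifs with h
  · constructor
    · intro hi
      have := Nat.mul_le_mul_left k (Nat.lt_succ_iff.mp hi)
      omega
    · intro hi
      by_contra hc
      have := Nat.mul_le_mul_left k (not_lt.mp hc)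
      rw [mul_add] at this
      omega
  · constructor
    · intro hi
      have := Nat.mul_le_mul_left k (Nat.succ_le_iff.mpr hi)
      rw [Nat.mul_succ] at this
      omega
    · intro hi
      by_contra hc
      have := Nat.mul_le_mul_left k (not_lt.mp hc)
      omega

/-- position equivalence -/
def posE (n k : ℕ) (hk : 1 ≤ k) : (Σ j : Fin k, Fin (sz n k j)) ≃ Fin n where
  toFun q := ⟨q.1 + k * q.2, (lt_sz n k q.1 q.2 q.1.2).1 q.2.2⟩
  invFun p := ⟨⟨p % k, Nat.mod_lt _ hk⟩, ⟨p / k, (lt_sz n k _ _ (Nat.mod_lt _ hk)).2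
    (by rw [Nat.mod_add_div]; exact p.2)⟩⟩
  left_inv := by
    rintro ⟨⟨j, hj⟩, ⟨i, hi⟩⟩
    have h1 : (j + k * i) % k = j := by rw [Nat.add_mul_mod_self_left, Nat.mod_eq_of_lt hj]
    have h2 : (j + k * i) / k = i := by
      rw [Nat.add_mul_div_left _ _ hk, Nat.div_eq_of_lt hj, zero_add]
    refine Sigma.ext (by simp [h1]) ?_
    simp only
    rw [Fin.heq_ext_iff (by simp only [h1])]
    exact h2
  right_inv := by
    intro p
    ext
    simp [Nat.mod_add_div]

theorem sum_split (N k : ℕ) (hk : 1 ≤ k) (f : ℕ → ℕ) :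
    ∑ p ∈ range N, f p = ∑ j : Fin k, ∑ i ∈ range (sz N k j), f (j + k * i) := by
  rw [← Fin.sum_univ_eq_sum_range, ← (posE N k hk).sum_comp, Fintype.sum_sigma]
  apply sum_congr rfl
  intro j _
  rw [← Fin.sum_univ_eq_sum_range (fun i => f (j + k * i))]
  rfl

theorem sz_sub (n k j : ℕ) (hj : j < k) : sz (n - k) k j = sz n k j - 1 := by
  apply eq_of_forall_lt_iff
  intro i
  have h1 := lt_sz n k j (i + 1) hj
  have h2 := lt_sz (n - k) k j i hj
  rw [mul_add] at h1
  omega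

theorem ext_pos (n k : ℕ) (hk : 1 ≤ k) (u : Fin n → ℤ) (j : Fin k) (i : ℕ) :
    extZ u (j + k * i) = extZ (fun i => u (posE n k hk ⟨j, i⟩)) i := by
  unfold extZ
  by_cases h : i < sz n k j
  · rw [dif_pos h, dif_pos ((lt_sz n k j i j.2).1 h)]
    rfl
  · rw [dif_neg h, dif_neg (fun hc => h ((lt_sz n k j i j.2).2 hc))]

/-- class statistic -/
def stat (n k : ℕ) (j : Fin k) (u : Fin (sz n k j) → ℤ) : ℕ :=
  cls (sz n k j) (extZ u) + if (j : ℕ) = k - 1 then ng (extZ u 0) else 0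

theorem desB_split (n k : ℕ) (hk : 1 ≤ k) (σ : Equiv.Perm (Fin n)) (ε : Fin n → Bool) :
    desB n k (bval n σ ε) = ∑ j : Fin k, stat n k j
      (fun i => sg (ε (posE n k hk ⟨j, i⟩)) ((σ (posE n k hk ⟨j, i⟩) : ℕ) + 1)) := by
  rw [desB_eq n k hk, sum_split _ k hk]
  unfold stat
  rw [sum_add_distrib]
  congr 1
  · apply sum_congr rfl
    intro j _
    rw [cls, card_filter, sz_sub n k j j.2]
    apply sum_congr rfl
    intro i _
    have : (j : ℕ) + k * i + k = j + k * (i + 1) := by ring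
    rw [this, ext_pos n k hk, ext_pos n k hk]
  · rw [Finset.sum_eq_single (⟨k - 1, by omega⟩ : Fin k)]
    · rw [if_pos rfl, ← ext_pos n k hk (fun q => sg (ε q) ((σ q : ℕ) + 1)) ⟨k - 1, by omega⟩ 0]
      simp
    · intro b _ hb
      rw [if_neg]
      intro hc
      exact hb (Fin.ext hc)
    · simp

theorem key {R : Type*} [CommRing R] (x : R) (n k : ℕ) (hk : 1 ≤ k) :
    (∏ j : Fin k, ((sz n k j).factorial : R)) *
      ∑ σ : Equiv.Perm (Fin n), ∑ ε : Fin n → Bool, x ^ desB n k (bval n σ ε) =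
    (n.factorial : R) * ∏ j : Fin k,
      if (j : ℕ) = k - 1 then EulB (sz n k j) x else 2 ^ (sz n k j) * EulA (sz n k j) x := by
  set E := posE n k hk with hE
  let H := ∀ j : Fin k, Equiv.Perm (Fin (sz n k j))
  have hcard : (Fintype.card H : R) = ∏ j : Fin k, ((sz n k j).factorial : R) := by
    simp [H, Fintype.card_pi, Fintype.card_perm]
  let act : H → Equiv.Perm (Fin n) := fun h => E.permCongr (Equiv.sigmaCongrRight h)
  have hact : ∀ (h : H) j i, act h (E ⟨j, i⟩) = E ⟨j, h j i⟩ := by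
    intro h j i
    simp [act, Equiv.permCongr_apply]
  let F : Equiv.Perm (Fin n) → R := fun σ => ∑ ε : Fin n → Bool, x ^ desB n k (bval n σ ε)
  have h1 : ∀ h : H, ∑ σ, F (σ * act h) = ∑ σ, F σ := fun h =>
    Equiv.sum_comp (Equiv.mulRight (act h)) F
  have h2 : ∀ σ, ∑ h : H, F (σ * act h) = ∏ j : Fin k,
      if (j : ℕ) = k - 1 then EulB (sz n k j) x else 2 ^ (sz n k j) * EulA (sz n k j) x := by
    intro σ
    have step : ∀ h : H, F (σ * act h) = ∏ j : Fin k, ∑ δ : Fin (sz n k j) → Bool,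
        x ^ stat n k j (fun i => sg (δ i) ((σ (E ⟨j, h j i⟩) : ℕ) + 1)) := by
      intro h
      rw [Fintype.prod_sum]
      simp only [F]
      rw [← (Equiv.arrowCongr E (Equiv.refl Bool)).sum_comp,
        ← (Equiv.piCurry (fun (j : Fin k) (_ : Fin (sz n k j)) => Bool)).symm.sum_comp]
      apply sum_congr rfl
      intro δ _
      rw [desB_split n k hk, ← prod_pow_eq_pow_sum]
      apply prod_congr rfl
      intro j _
      congr 2
      funext i
      rw [← hE, Equiv.Perm.mul_apply, hact]
      simp only [Equiv.piCurry, Equiv.coe_fn_symm_mk, Equiv.arrowCongr_apply, Equiv.coe_refl,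
        Function.comp, id, Sigma.uncurry]
      have hs : ∀ q q' : (Σ j : Fin k, Fin (sz n k j)), q = q' → δ q.1 q.2 = δ q'.1 q'.2 := by
        rintro q _ rfl
        rfl
      rw [hs _ _ (E.symm_apply_apply ⟨j, i⟩)]
    simp_rw [step]
    have := (Fintype.prod_sum (fun (j : Fin k) (hj : Equiv.Perm (Fin (sz n k j))) =>
      ∑ δ : Fin (sz n k j) → Bool,
        x ^ stat n k j (fun i => sg (δ i) ((σ (E ⟨j, hj i⟩) : ℕ) + 1)))).symm
    refine this.trans ?_
    apply prod_congr rfl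
    intro j _
    have hinj : Function.Injective (fun i : Fin (sz n k j) => ((σ (E ⟨j, i⟩) : ℕ) : ℤ) + 1) := by
      intro a b hab
      simp only [add_left_inj, Nat.cast_inj] at hab
      have := E.injective (σ.injective (Fin.ext hab))
      simpa using this
    have hpos : ∀ i : Fin (sz n k j), 0 < ((σ (E ⟨j, i⟩) : ℕ) : ℤ) + 1 := by
      intro i; positivity
    split_ifs with hj
    · rw [← lemB x _ hinj hpos]
      simp only [stat, if_pos hj]
    · rw [← lemA2 x _ hinj hpos]
      simp only [stat, if_neg hj, add_zero]
  have h3 : ∑ h : H, ∑ σ, F (σ * act h) = ∑ σ, ∑ h : H, F (σ * act h) := sum_comm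
  simp_rw [h1, h2] at h3
  simp only [sum_const, card_univ, nsmul_eq_mul, Fintype.card_perm, Fintype.card_fin] at h3
  rw [hcard] at h3
  exact h3

theorem prod_sz {M : Type*} [CommMonoid M] (n k l : ℕ) (f : ℕ → M) (hl : n % k ≤ l) :
    ∏ j : Fin l, f (sz n k j) = f (n / k + 1) ^ (n % k) * f (n / k) ^ (l - n % k) := by
  rw [Fin.prod_univ_eq_prod_range (fun j => f (sz n k j)) l, ← prod_range_mul_prod_Ico _ hl]
  congr 1
  · rw [prod_congr rfl (g := fun _ => f (n / k + 1))]
    · simp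
    · intro j hj
      rw [mem_range] at hj
      simp [sz, hj]
  · rw [prod_congr rfl (g := fun _ => f (n / k))]
    · simp
    · intro j hj
      rw [mem_Ico] at hj
      simp [sz, not_lt.mpr hj.1]

theorem sum_sz (n k : ℕ) (hk : 1 ≤ k) : ∑ j : Fin k, sz n k j = n := by
  have := Fintype.card_congr (posE n k hk)
  simpa using this

theorem Mnk_mul (n k : ℕ) (hk : 1 ≤ k) :
    (∏ j : Fin k, (sz n k j).factorial) * Mnk n k = n.factorial := by
  have h := Nat.prod_factorial_dvd_factorial_sum (univ : Finset (Fin k)) (fun j => sz n k j)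
  rw [sum_sz n k hk] at h
  have h2 := prod_sz n k k Nat.factorial (Nat.mod_lt _ hk).le
  unfold Mnk
  rw [← h2]
  exact Nat.mul_div_cancel' h

theorem main_poly (n k : ℕ) (hk : 1 ≤ k) (x : Polynomial ℤ) :
    ∑ σ : Equiv.Perm (Fin n), ∑ ε : Fin n → Bool, x ^ desB n k (bval n σ ε) =
      2 ^ (n - n / k) * (Mnk n k : Polynomial ℤ) * EulB (n / k) x *
        (EulA (n / k) x) ^ (k - n % k - 1) * (EulA (n / k + 1) x) ^ (n % k) := by
  have h := key x n k hk
  rw [← Mnk_mul n k hk] at h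
  push_cast at h
  rw [mul_assoc] at h
  have hne : (∏ j : Fin k, ((sz n k j).factorial : Polynomial ℤ)) ≠ 0 := by
    rw [prod_ne_zero_iff]
    intro j _
    exact_mod_cast Nat.factorial_ne_zero _
  rw [mul_left_cancel₀ hne h]
  obtain ⟨l, rfl⟩ : ∃ l, k = l + 1 := ⟨k - 1, by omega⟩
  have hr : n % (l + 1) ≤ l := Nat.lt_succ_iff.mp (Nat.mod_lt _ hk)
  rw [Fin.prod_univ_castSucc]
  have e1 : ∀ j : Fin l, ((j.castSucc : Fin (l + 1)) : ℕ) = l + 1 - 1 ↔ False := by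
    intro j
    have := j.2
    rw [iff_false]
    simp only [Fin.val_castSucc]
    omega
  simp only [e1, if_false]
  simp only [Fin.val_castSucc, Fin.val_last]
  have e2 : sz n (l + 1) l = n / (l + 1) := by simp [sz, not_lt.mpr hr]
  have e3 := sum_sz n (l + 1) hk
  rw [Fin.sum_univ_castSucc] at e3
  simp only [Fin.val_castSucc, Fin.val_last, e2] at e3
  have e4 : n - n / (l + 1) = ∑ j : Fin l, sz n (l + 1) j := by omega
  rw [prod_mul_distrib, prod_pow_eq_pow_sum, ← e4, e2,
    prod_sz n (l + 1) l (fun m => EulA m x) hr]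
  have e5 : l + 1 - n % (l + 1) - 1 = l - n % (l + 1) := by omega
  rw [e5]
  simp
  ring

theorem EulA_map {R S : Type*} [CommRing R] [CommRing S] (f : R →+* S) (m : ℕ) (x : R) :
    f (EulA m x) = EulA m (f x) := by
  simp [EulA]

theorem EulB_map {R S : Type*} [CommRing R] [CommRing S] (f : R →+* S) (m : ℕ) (x : R) :
    f (EulB m x) = EulB m (f x) := by
  simp [EulB]

/-- Theorem 15, Eq. (9):
`Σ_{π ∈ B_n} x^{des_k^B(π)} = 2^{n-d} M_{n,k} B_d(x) A_d(x)^{k-r-1} A_{d+1}(x)^r`. -/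
theorem stmt7 (n k : ℕ) (hk : 1 ≤ k) (hkn : k ≤ n) (R : Type*) [CommRing R] (x : R) :
    ∑ σ : Equiv.Perm (Fin n), ∑ ε : Fin n → Bool, x ^ desB n k (bval n σ ε) =
      2 ^ (n - n / k) * (Mnk n k : R) * EulB (n / k) x *
        (EulA (n / k) x) ^ (k - n % k - 1) * (EulA (n / k + 1) x) ^ (n % k) := by
  have h := congrArg (Polynomial.eval₂RingHom (Int.castRingHom R) x) (main_poly n k hk Polynomial.X)
  simp only [map_sum, map_mul, map_pow, EulA_map, EulB_map, map_natCast, map_ofNat] at h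
  simpa using h
end

section
/- For any n ≥ k ≥ 1 with n = dk + r, 0 ≤ r < k, the width-k flag-descent generating function satisfies Σ_{π ∈ B_n} x^{fdes_k^B(π)} = 2^{n-d} · M_{n,k} · F_d(x) · A_d(x²)^{k-r-1} · A_{d+1}(x²)^r, where F_d(x) = Σ_{π ∈ B_d} x^{fdes^B(π)} is the flag descent polynomial and fdes^B(π) = des^B(π) + des^A(π). -/
open Finset

/-- The flag-descent polynomial `F_m(x) = Σ_{π ∈ B_m} x^{fdes^B(π)}` where
`fdes^B = des^B + des^A`. -/
def FlagB {R : Type*} [CommRing R] (m : ℕ) (x : R) : R :=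
  ∑ σ : Equiv.Perm (Fin m), ∑ ε : Fin m → Bool,
    x ^ (desB m 1 (bval m σ ε) + desA m 1 (bval m σ ε))

/-- signed value -/
def sv8 (a : ℕ) (b : Bool) : ℤ := if b then -((a : ℤ) + 1) else (a : ℤ) + 1

/-- descents of width `k` of a finite word -/
def dk8 (n k : ℕ) (u : Fin n → ℤ) : ℕ :=
  (univ.filter fun i : Fin n => ∃ h : (i : ℕ) + k < n, u ⟨i + k, h⟩ < u i).card

/-- indicator of a negative entry at position `p` -/
def ng8 (n p : ℕ) (u : Fin n → ℤ) : ℕ :=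
  if ∃ h : p < n, u ⟨p, h⟩ < 0 then 1 else 0

lemma bval_pos8 (n : ℕ) (σ : Equiv.Perm (Fin n)) (ε : Fin n → Bool) (i : ℕ) (h : i < n) (z : ℤ)
    (hz : z = (i : ℤ) + 1) :
    bval n σ ε z = sv8 (σ ⟨i, h⟩) (ε ⟨i, h⟩) := by
  have e : z.natAbs = i + 1 := by omega
  have hs : Int.sign z = 1 := Int.sign_eq_one_of_pos (by omega)
  have e2 : z.natAbs - 1 = i := by omega
  unfold bval sv8
  rw [dif_pos (by omega), hs]
  simp only [e2, one_mul]

lemma desA_eq8 (n k : ℕ) (σ : Equiv.Perm (Fin n)) (ε : Fin n → Bool) (hk : 1 ≤ k) :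
    desA n k (bval n σ ε) = dk8 n k (fun i => sv8 (σ i) (ε i)) := by
  unfold desA dk8
  symm
  refine Finset.card_bij (fun i _ => (i : ℕ) + 1) ?_ ?_ ?_
  · intro i hi
    simp only [mem_filter, mem_univ, true_and, mem_Icc] at hi ⊢
    obtain ⟨h, hlt⟩ := hi
    refine ⟨by omega, ?_⟩
    rw [bval_pos8 n σ ε i i.2 _ (by push_cast; ring),
      bval_pos8 n σ ε (i + k) h _ (by push_cast; ring)]
    exact hlt
  · intro a _ b _ h
    exact Fin.ext (by omega)
  · intro b hb
    simp only [mem_filter, mem_Icc] at hb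
    obtain ⟨⟨h1, h2⟩, hlt⟩ := hb
    have h3 : b - 1 < n := by omega
    have h4 : b - 1 + k < n := by omega
    refine ⟨⟨b - 1, h3⟩, ?_, by simp; omega⟩
    simp only [mem_filter, mem_univ, true_and]
    refine ⟨h4, ?_⟩
    rw [bval_pos8 n σ ε (b - 1) h3 _ (by omega),
      bval_pos8 n σ ε (b - 1 + k) h4 _ (by omega)] at hlt
    exact hlt

lemma desB_eq8 (n k : ℕ) (σ : Equiv.Perm (Fin n)) (ε : Fin n → Bool) (hk : 1 ≤ k) (hkn : k ≤ n) :
    desB n k (bval n σ ε) = dk8 n k (fun i => sv8 (σ i) (ε i)) +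
      ng8 n (k - 1) (fun i => sv8 (σ i) (ε i)) := by
  rw [← desA_eq8 n k σ ε hk]
  unfold desB desA ng8
  have h0 : range (n - k + 1) = insert 0 (Icc 1 (n - k)) := by
    ext a; simp; omega
  have hz : bval n σ ε ((0 : ℕ) : ℤ) = 0 := by simp [bval]
  have h1 : k - 1 < n := by omega
  rw [h0, Finset.filter_insert, hz,
    bval_pos8 n σ ε (k - 1) h1 _ (by omega)]
  by_cases hneg : sv8 (σ ⟨k - 1, h1⟩) (ε ⟨k - 1, h1⟩) < 0
  · rw [if_pos hneg, if_pos ⟨h1, hneg⟩, Finset.card_insert_of_notMem (by simp)]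
  · rw [if_neg hneg, if_neg (by rintro ⟨_, h⟩; exact hneg h)]
    rfl

lemma sv8_lt (m : ℕ) (v : Fin m → ℕ) (hv : StrictMono v) (a a' : Fin m) (b b' : Bool) :
    sv8 (v a) b < sv8 (v a') b' ↔ sv8 a b < sv8 a' b' := by
  have h1 : v a < v a' ↔ (a : ℕ) < a' := hv.lt_iff_lt
  have h2 : v a' < v a ↔ (a' : ℕ) < a := hv.lt_iff_lt
  unfold sv8
  cases b <;> cases b' <;> simp <;> omega

lemma sv8_neg (a : ℕ) (b : Bool) : sv8 a b < 0 ↔ b = true := by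
  unfold sv8
  cases b <;> simp <;> omega

section
variable {R : Type*} [CommRing R]

/-- weight of a chain -/
def gst8 (m : ℕ) (b : Prop) [Decidable b] (x : R) (u : Fin m → ℤ) : R :=
  x ^ (2 * dk8 m 1 u) * (if b then x ^ ng8 m 0 u else 1)

lemma exists_sort8 {m : ℕ} {α : Type*} [LinearOrder α] (v : Fin m → α)
    (hv : Function.Injective v) : ∃ ρ : Equiv.Perm (Fin m), StrictMono (v ∘ ρ) :=
  ⟨Tuple.sort v, (Tuple.monotone_sort v).strictMono_of_injective
    (hv.comp (Tuple.sort v).injective)⟩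

lemma std8 (m : ℕ) (b : Prop) [Decidable b] (x : R) (v : Fin m → ℕ) (hv : Function.Injective v) :
    ∑ τ : Equiv.Perm (Fin m), ∑ ε : Fin m → Bool, gst8 m b x (fun t => sv8 (v (τ t)) (ε t)) =
    ∑ τ : Equiv.Perm (Fin m), ∑ ε : Fin m → Bool, gst8 m b x (fun t => sv8 (τ t) (ε t)) := by
  obtain ⟨ρ, hρ⟩ := exists_sort8 v hv
  rw [← Equiv.sum_comp (Equiv.mulLeft ρ)]
  refine Finset.sum_congr rfl fun τ _ => Finset.sum_congr rfl fun ε _ => ?_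
  have h : ∀ a a' b b', sv8 (v (ρ a)) b < sv8 (v (ρ a')) b' ↔ sv8 a b < sv8 a' b' :=
    sv8_lt m (v ∘ ρ) hρ
  simp only [gst8, dk8, ng8, Equiv.coe_mulLeft, Equiv.Perm.mul_apply, h, sv8_neg]

lemma stdA8 (m : ℕ) (y : R) (u : Fin m → ℤ) (hu : Function.Injective u) :
    ∑ τ : Equiv.Perm (Fin m), y ^ dk8 m 1 (fun t => u (τ t)) =
    ∑ τ : Equiv.Perm (Fin m), y ^ dk8 m 1 (fun t => sv8 (τ t) false) := by
  obtain ⟨ρ, hρ⟩ := exists_sort8 u hu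
  rw [← Equiv.sum_comp (Equiv.mulLeft ρ)]
  refine Finset.sum_congr rfl fun τ _ => ?_
  have h : ∀ a a', u (ρ a) < u (ρ a') ↔ sv8 a false < sv8 a' false := by
    intro a a'
    have : u (ρ a) < u (ρ a') ↔ a < a' := hρ.lt_iff_lt
    rw [this]
    simp [sv8]
  simp only [dk8, Equiv.coe_mulLeft, Equiv.Perm.mul_apply, h]

lemma sv8_inj (m : ℕ) (δ : Fin m → Bool) : Function.Injective fun s : Fin m => sv8 s (δ s) := by
  intro a b h
  apply Fin.ext
  simp only [sv8] at h
  split_ifs at h <;> omega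

lemma plain8 (m : ℕ) (x : R) :
    ∑ τ : Equiv.Perm (Fin m), ∑ ε : Fin m → Bool, gst8 m False x (fun t => sv8 (τ t) (ε t)) =
      2 ^ m * EulA m (x ^ 2) := by
  have h1 : ∀ τ : Equiv.Perm (Fin m),
      ∑ ε : Fin m → Bool, gst8 m False x (fun t => sv8 (τ t) (ε t)) =
      ∑ δ : Fin m → Bool, gst8 m False x (fun t => sv8 (τ t) (δ (τ t))) := by
    intro τ
    rw [← Equiv.sum_comp (Equiv.arrowCongr τ.symm (Equiv.refl Bool))]
    rfl
  simp_rw [h1]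
  rw [Finset.sum_comm]
  have h2 : ∀ δ : Fin m → Bool, ∑ τ : Equiv.Perm (Fin m),
      gst8 m False x (fun t => sv8 (τ t) (δ (τ t))) = EulA m (x ^ 2) := by
    intro δ
    have := stdA8 m (x ^ 2) _ (sv8_inj m δ)
    simp only [gst8, if_false, mul_one, pow_mul, EulA, desA_eq8 _ 1 _ _ le_rfl]
    exact this
  simp [h2]

lemma flag8 (m : ℕ) (hm : 1 ≤ m) (x : R) :
    ∑ τ : Equiv.Perm (Fin m), ∑ ε : Fin m → Bool, gst8 m True x (fun t => sv8 (τ t) (ε t)) =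
      FlagB m x := by
  unfold FlagB
  refine Finset.sum_congr rfl fun τ _ => Finset.sum_congr rfl fun ε _ => ?_
  rw [desB_eq8 _ _ _ _ le_rfl hm, desA_eq8 _ _ _ _ le_rfl]
  simp only [gst8, if_true]
  rw [← pow_add]
  congr 1
  simp only [Nat.sub_self]
  ring

end

/-- size of the chain with residue `j` -/
def ms8 (n k : ℕ) (j : Fin k) : ℕ := if (j : ℕ) < n % k then n / k + 1 else n / k

lemma lt_ms8 (n k : ℕ) (j : Fin k) (t : ℕ) : t < ms8 n k j ↔ (j : ℕ) + t * k < n := by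
  have hj := j.2
  have hn := Nat.div_add_mod n k
  have hr := Nat.mod_lt n (show 0 < k by omega)
  generalize n / k = d at *
  generalize hr' : n % k = r at *
  unfold ms8
  rw [hr']
  have hd : ∀ d' : ℕ, n / k = d' → True := fun _ _ => trivial
  have hdd : n / k = d := by
    rw [← hn, Nat.mul_add_div (by omega), Nat.div_eq_of_lt hr, add_zero]
  rw [hdd]
  constructor
  · intro h
    split_ifs at h with hc
    · have : t * k ≤ d * k := Nat.mul_le_mul_right _ (by omega)
      nlinarith
    · have : (t + 1) * k ≤ d * k := Nat.mul_le_mul_right _ (by omega)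
      nlinarith
  · intro h
    by_contra hc
    split_ifs at hc with hc'
    · have : (d + 1) * k ≤ t * k := Nat.mul_le_mul_right _ (by omega)
      nlinarith
    · have : d * k ≤ t * k := Nat.mul_le_mul_right _ (by omega)
      nlinarith

lemma sig_ext8 (n k : ℕ) (p q : Σ j : Fin k, Fin (ms8 n k j)) (h1 : (p.1 : ℕ) = q.1)
    (h2 : (p.2 : ℕ) = q.2) : p = q := by
  obtain ⟨a, b⟩ := p
  obtain ⟨c, d⟩ := q
  obtain rfl : a = c := Fin.ext h1
  obtain rfl : b = d := Fin.ext h2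
  rfl

/-- chains decomposition -/
def eq8 (n k : ℕ) (hk : 1 ≤ k) : (Σ j : Fin k, Fin (ms8 n k j)) ≃ Fin n where
  toFun p := ⟨p.1 + p.2 * k, (lt_ms8 n k p.1 p.2).1 p.2.2⟩
  invFun i := ⟨⟨i % k, Nat.mod_lt _ hk⟩, ⟨i / k, (lt_ms8 n k _ _).2 (by
    have := Nat.mod_add_div (i : ℕ) k
    rw [mul_comm] at this
    simp only [this, i.2])⟩⟩
  left_inv := by
    rintro ⟨⟨j, hj⟩, ⟨t, ht⟩⟩
    have h1 : (j + t * k) % k = j := by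
      rw [Nat.add_mul_mod_self_right, Nat.mod_eq_of_lt hj]
    have h2 : (j + t * k) / k = t := by
      rw [Nat.add_mul_div_right _ _ (by omega), Nat.div_eq_of_lt hj, zero_add]
    exact sig_ext8 n k _ _ h1 h2
  right_inv := by
    intro i
    apply Fin.ext
    simp only
    rw [mul_comm]; exact Nat.mod_add_div (i : ℕ) k

lemma dk_split8 (n k : ℕ) (hk : 1 ≤ k) (u : Fin n → ℤ) :
    dk8 n k u = ∑ j : Fin k, dk8 (ms8 n k j) 1 (fun t => u (eq8 n k hk ⟨j, t⟩)) := by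
  unfold dk8
  simp_rw [Finset.card_filter]
  rw [← Equiv.sum_comp (eq8 n k hk), Fintype.sum_sigma]
  refine Finset.sum_congr rfl fun j _ => Finset.sum_congr rfl fun t _ => ?_
  refine if_congr ?_ rfl rfl
  have hval : ((eq8 n k hk ⟨j, t⟩ : Fin n) : ℕ) = j + t * k := rfl
  have hval2 : ∀ h : (t : ℕ) + 1 < ms8 n k j,
    ((eq8 n k hk ⟨j, ⟨t + 1, h⟩⟩ : Fin n) : ℕ) = j + (t + 1) * k := fun h => rfl
  constructor
  · rintro ⟨h, hu⟩
    have h' : (t : ℕ) + 1 < ms8 n k j := (lt_ms8 n k j _).2 (by rw [hval] at h; linarith)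
    refine ⟨h', ?_⟩
    convert hu using 2
    apply Fin.ext
    simp only [hval2, hval]; ring
  · rintro ⟨h, hu⟩
    have h' := (lt_ms8 n k j _).1 h
    refine ⟨by rw [hval]; linarith, ?_⟩
    convert hu using 2
    apply Fin.ext
    simp only [hval2, hval]; ring

lemma ng_split8 (n k : ℕ) (hk : 1 ≤ k) (u : Fin n → ℤ) :
    ng8 n (k - 1) u = ng8 (ms8 n k ⟨k - 1, by omega⟩) 0
      (fun t => u (eq8 n k hk ⟨⟨k - 1, by omega⟩, t⟩)) := by
  unfold ng8
  refine if_congr ?_ rfl rfl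
  have hval2 : ∀ h : 0 < ms8 n k ⟨k - 1, by omega⟩,
    ((eq8 n k hk ⟨⟨k - 1, by omega⟩, ⟨0, h⟩⟩ : Fin n) : ℕ) = k - 1 + 0 * k := fun h => rfl
  constructor
  · rintro ⟨h, hu⟩
    refine ⟨(lt_ms8 n k _ _).2 (by simpa using h), ?_⟩
    convert hu using 2
    apply Fin.ext
    rw [hval2]; simp
  · rintro ⟨h, hu⟩
    refine ⟨by simpa using (lt_ms8 n k _ _).1 h, ?_⟩
    convert hu using 2
    apply Fin.ext
    rw [hval2]; simp

section
variable {R : Type*} [CommRing R]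

lemma weight8 (n k : ℕ) (hk : 1 ≤ k) (hkn : k ≤ n) (x : R)
    (σ : Equiv.Perm (Fin n)) (ε : Fin n → Bool) :
    x ^ (desA n k (bval n σ ε) + desB n k (bval n σ ε)) =
      ∏ j : Fin k, gst8 (ms8 n k j) ((j : ℕ) = k - 1) x
        (fun t => sv8 (σ (eq8 n k hk ⟨j, t⟩)) (ε (eq8 n k hk ⟨j, t⟩))) := by
  rw [desA_eq8 _ _ _ _ hk, desB_eq8 _ _ _ _ hk hkn, ← add_assoc, ← two_mul, pow_add,
    dk_split8 n k hk, ng_split8 n k hk, Finset.mul_sum]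
  simp only [gst8]
  rw [Finset.prod_mul_distrib, Finset.prod_pow_eq_pow_sum]
  congr 1
  rw [Finset.prod_eq_single (⟨k - 1, by omega⟩ : Fin k)]
  · simp
  · intro b _ hb
    rw [if_neg]
    intro h
    exact hb (Fin.ext h)
  · simp

lemma avg8 (n k : ℕ) (hk : 1 ≤ k) (hkn : k ≤ n) (x : R) :
    ((∏ j : Fin k, (ms8 n k j).factorial : ℕ) : R) *
      ∑ σ : Equiv.Perm (Fin n), ∑ ε : Fin n → Bool,
        x ^ (desA n k (bval n σ ε) + desB n k (bval n σ ε)) =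
    (n.factorial : R) * ∏ j : Fin k, ∑ τ : Equiv.Perm (Fin (ms8 n k j)),
      ∑ ε : Fin (ms8 n k j) → Bool,
        gst8 (ms8 n k j) ((j : ℕ) = k - 1) x (fun t => sv8 (τ t) (ε t)) := by
  set e := eq8 n k hk with he
  have hcard : (∏ j : Fin k, (ms8 n k j).factorial : ℕ) =
      Fintype.card (∀ j : Fin k, Equiv.Perm (Fin (ms8 n k j))) := by
    rw [Fintype.card_pi]
    simp [Fintype.card_perm]
  have hS : ∀ h : ∀ j : Fin k, Equiv.Perm (Fin (ms8 n k j)),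
      ∑ σ : Equiv.Perm (Fin n), ∑ ε : Fin n → Bool,
        x ^ (desA n k (bval n σ ε) + desB n k (bval n σ ε)) =
      ∑ σ : Equiv.Perm (Fin n), ∑ ε : ∀ j : Fin k, Fin (ms8 n k j) → Bool,
        ∏ j : Fin k, gst8 (ms8 n k j) ((j : ℕ) = k - 1) x
        (fun t => sv8 (σ (e ⟨j, h j t⟩)) (ε j t)) := by
    intro h
    rw [← Equiv.sum_comp (Equiv.mulRight ((e.symm.trans (Equiv.sigmaCongrRight h)).trans e))]
    refine Finset.sum_congr rfl fun σ _ => ?_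
    rw [← Equiv.sum_comp ((Equiv.arrowCongr e.symm (Equiv.refl Bool)).trans
      (Equiv.piCurry (fun _ _ => Bool)))]
    refine Finset.sum_congr rfl fun ε _ => ?_
    rw [weight8 n k hk hkn]
    refine Finset.prod_congr rfl fun j _ => ?_
    congr 1
    funext t
    simp [← he, Equiv.piCurry, Sigma.curry]
  rw [hcard, ← nsmul_eq_mul, ← Finset.card_univ, ← Finset.sum_const]
  rw [Finset.sum_congr rfl fun h _ => hS h, Finset.sum_comm]
  have hP : ∀ σ : Equiv.Perm (Fin n),
      ∑ h : (∀ j : Fin k, Equiv.Perm (Fin (ms8 n k j))),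
      ∑ ε : ∀ j : Fin k, Fin (ms8 n k j) → Bool,
        ∏ j : Fin k, gst8 (ms8 n k j) ((j : ℕ) = k - 1) x
        (fun t => sv8 (σ (e ⟨j, h j t⟩)) (ε j t)) =
      ∏ j : Fin k, ∑ τ : Equiv.Perm (Fin (ms8 n k j)),
      ∑ ε : Fin (ms8 n k j) → Bool,
        gst8 (ms8 n k j) ((j : ℕ) = k - 1) x (fun t => sv8 (τ t) (ε t)) := by
    intro σ
    rw [← Finset.prod_congr rfl fun j _ => std8 (ms8 n k j) ((j : ℕ) = k - 1) x
      (fun t => ((σ (e ⟨j, t⟩) : Fin n) : ℕ)) (fun a b hab => by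
        have := e.injective (σ.injective (Fin.ext hab))
        simpa using this)]
    rw [Fintype.prod_sum]
    refine Finset.sum_congr rfl fun h _ => ?_
    rw [Fintype.prod_sum]
  rw [Finset.sum_congr rfl fun σ _ => hP σ]
  simp [Fintype.card_perm]

lemma prodP8 (n k : ℕ) (hk : 1 ≤ k) (hkn : k ≤ n) (x : R) :
    ∏ j : Fin k, ∑ τ : Equiv.Perm (Fin (ms8 n k j)),
      ∑ ε : Fin (ms8 n k j) → Bool,
        gst8 (ms8 n k j) ((j : ℕ) = k - 1) x (fun t => sv8 (τ t) (ε t)) =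
    2 ^ (n - n / k) * FlagB (n / k) x *
        (EulA (n / k) (x ^ 2)) ^ (k - n % k - 1) * (EulA (n / k + 1) (x ^ 2)) ^ (n % k) := by
  have hd : 1 ≤ n / k := (Nat.one_le_div_iff hk).2 hkn
  have hr : n % k < k := Nat.mod_lt _ hk
  have hn := Nat.div_add_mod n k
  have hj : ∀ j : Fin k, ∑ τ : Equiv.Perm (Fin (ms8 n k j)),
      ∑ ε : Fin (ms8 n k j) → Bool,
        gst8 (ms8 n k j) ((j : ℕ) = k - 1) x (fun t => sv8 (τ t) (ε t)) =
      (fun j : ℕ => if j = k - 1 then FlagB (n / k) x else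
        if j < n % k then 2 ^ (n / k + 1) * EulA (n / k + 1) (x ^ 2)
        else 2 ^ (n / k) * EulA (n / k) (x ^ 2)) j := by
    intro j
    simp only
    by_cases h1 : (j : ℕ) = k - 1
    · have hm : ms8 n k j = n / k := by unfold ms8; rw [if_neg (by omega)]
      rw [if_pos h1, ← flag8 _ hd, hm]
      simp only [h1]
    · rw [if_neg h1]
      have h3 := plain8 (ms8 n k j) x
      simp only [h1]
      rw [h3]
      unfold ms8
      split_ifs <;> rfl
  rw [Finset.prod_congr rfl fun j _ => hj j]
  rw [Fin.prod_univ_eq_prod_range (fun j : ℕ => if j = k - 1 then FlagB (n / k) x else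
        if j < n % k then 2 ^ (n / k + 1) * EulA (n / k + 1) (x ^ 2)
        else 2 ^ (n / k) * EulA (n / k) (x ^ 2)) k]
  generalize n / k = d at *
  generalize n % k = r at *
  obtain ⟨s, rfl⟩ : ∃ s, k = r + s + 1 := ⟨k - r - 1, by omega⟩
  rw [Finset.prod_range_succ, Finset.prod_range_add]
  have hA : ∀ i ∈ range r, (if i = r + s + 1 - 1 then FlagB d x else
        if i < r then 2 ^ (d + 1) * EulA (d + 1) (x ^ 2)
        else 2 ^ d * EulA d (x ^ 2)) = 2 ^ (d + 1) * EulA (d + 1) (x ^ 2) := by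
    intro i hi
    have := Finset.mem_range.1 hi
    rw [if_neg (by omega), if_pos this]
  have hB : ∀ i ∈ range s, (if r + i = r + s + 1 - 1 then FlagB d x else
        if r + i < r then 2 ^ (d + 1) * EulA (d + 1) (x ^ 2)
        else 2 ^ d * EulA d (x ^ 2)) = 2 ^ d * EulA d (x ^ 2) := by
    intro i hi
    have := Finset.mem_range.1 hi
    rw [if_neg (by omega), if_neg (by omega)]
  rw [Finset.prod_congr rfl hA, Finset.prod_congr rfl hB, if_pos (by omega)]
  have hnd : n - d = (d + 1) * r + d * s := by
    have : n = (d + 1) * r + d * s + d := by rw [← hn]; ring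
    omega
  have hs : r + s + 1 - r - 1 = s := by omega
  rw [hnd, hs, prod_const, prod_const, card_range, card_range, pow_add 2 ((d + 1) * r), pow_mul, pow_mul, mul_pow, mul_pow]
  ring

end

lemma prodms8 (n k : ℕ) (hk : 1 ≤ k) :
    ∏ j : Fin k, (ms8 n k j).factorial =
      (n / k + 1).factorial ^ (n % k) * (n / k).factorial ^ (k - n % k) := by
  have hr : n % k < k := Nat.mod_lt _ hk
  unfold ms8
  rw [Fin.prod_univ_eq_prod_range (fun j : ℕ =>
    (if j < n % k then n / k + 1 else n / k).factorial) k]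
  generalize n / k = d at *
  generalize n % k = r at *
  obtain ⟨s, rfl⟩ : ∃ s, k = r + s := ⟨k - r, by omega⟩
  rw [Finset.prod_range_add]
  have hA : ∀ i ∈ range r, (if i < r then d + 1 else d).factorial = (d + 1).factorial := by
    intro i hi
    rw [if_pos (Finset.mem_range.1 hi)]
  rw [Finset.prod_congr rfl hA]
  simp

lemma summs8 (n k : ℕ) (hk : 1 ≤ k) : ∑ j : Fin k, ms8 n k j = n := by
  have := Fintype.card_congr (eq8 n k hk)
  simpa using this

lemma Mnk8 (n k : ℕ) (hk : 1 ≤ k) :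
    n.factorial = (∏ j : Fin k, (ms8 n k j).factorial) * Mnk n k := by
  unfold Mnk
  rw [← prodms8 n k hk]
  refine (Nat.mul_div_cancel' ?_).symm
  have := Nat.prod_factorial_dvd_factorial_sum (univ : Finset (Fin k)) (ms8 n k)
  rwa [summs8 n k hk] at this

open Polynomial in
lemma poly8 (n k : ℕ) (hk : 1 ≤ k) (hkn : k ≤ n) :
    ∑ σ : Equiv.Perm (Fin n), ∑ ε : Fin n → Bool,
        (X : ℤ[X]) ^ (desA n k (bval n σ ε) + desB n k (bval n σ ε)) =
      2 ^ (n - n / k) * (Mnk n k : ℤ[X]) * FlagB (n / k) X *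
        (EulA (n / k) (X ^ 2)) ^ (k - n % k - 1) * (EulA (n / k + 1) (X ^ 2)) ^ (n % k) := by
  have h := avg8 n k hk hkn (X : ℤ[X])
  rw [prodP8 n k hk hkn, Mnk8 n k hk, Nat.cast_mul, mul_assoc] at h
  have h0 : ((∏ j : Fin k, (ms8 n k j).factorial : ℕ) : ℤ[X]) ≠ 0 := by
    rw [Nat.cast_ne_zero]
    exact Finset.prod_ne_zero_iff.2 fun j _ => Nat.factorial_ne_zero _
  rw [mul_left_cancel₀ h0 h]
  ring

/-- Theorem 15, Eq. (10):
`Σ_{π ∈ B_n} x^{fdes_k^B(π)} = 2^{n-d} M_{n,k} F_d(x) A_d(x²)^{k-r-1} A_{d+1}(x²)^r`,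
where `fdes_k^B = des_k^A + des_k^B`. -/
theorem stmt8 (n k : ℕ) (hk : 1 ≤ k) (hkn : k ≤ n) (R : Type*) [CommRing R] (x : R) :
    ∑ σ : Equiv.Perm (Fin n), ∑ ε : Fin n → Bool,
        x ^ (desA n k (bval n σ ε) + desB n k (bval n σ ε)) =
      2 ^ (n - n / k) * (Mnk n k : R) * FlagB (n / k) x *
        (EulA (n / k) (x ^ 2)) ^ (k - n % k - 1) * (EulA (n / k + 1) (x ^ 2)) ^ (n % k) := by
  have h := congrArg (Polynomial.eval₂RingHom (Int.castRingHom R) x) (poly8 n k hk hkn)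
  simpa [EulA, FlagB, map_sum, map_mul, map_pow] using h
end

section
/- For any n ≥ k ≥ 1 with n = dk + r, 0 ≤ r < k, the width-k type-B inversion generating function satisfies Σ_{π ∈ B_n} x^{inv_k^B(π)} = 2^{k-1} · M_{n,k} · [d]_x^{k-r-1} · [d+1]_x^r · ([2d]_x!!)^{r+1} · ([2(d-1)]_x!!)^{k-r-1}. -/
open Finset

lemma aux_div_lt {n k j : ℕ} (hk : 1 ≤ k) : j < n ↔ j / k < n / k + if j % k < n % k then 1 else 0 := by
  have h1 := Nat.div_add_mod j k
  have h2 := Nat.div_add_mod n k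
  have h3 := Nat.mod_lt j hk
  have h4 := Nat.mod_lt n hk
  generalize j / k = a at *
  generalize n / k = b at *
  generalize j % k = s at *
  generalize n % k = t at *
  subst h1 h2
  split_ifs with h
  · constructor
    · intro hh
      by_contra hc
      have : b + 1 ≤ a := by omega
      have := Nat.mul_le_mul_left k this
      rw [Nat.mul_add] at this
      omega
    · intro hh
      have : a ≤ b := by omega
      have := Nat.mul_le_mul_left k this
      omega
  · constructor
    · intro hh
      by_contra hc
      have : b ≤ a := by omega
      have := Nat.mul_le_mul_left k this
      omega
    · intro hh
      have : a + 1 ≤ b := by omega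
      have := Nat.mul_le_mul_left k this
      rw [Nat.mul_add] at this
      omega

lemma aux_mk_mod {k c t : ℕ} (ht : t < k) : (c * k + t) % k = t := by
  rw [Nat.mul_add_mod_self_right, Nat.mod_eq_of_lt ht]

lemma aux_mk_div {k c t : ℕ} (ht : t < k) : (c * k + t) / k = c := by
  rw [Nat.add_comm, Nat.add_mul_div_right _ _ (by omega), Nat.div_eq_of_lt ht, zero_add]

lemma aux_prod {M : Type*} [CommMonoid M] (n k : ℕ) (hk : 1 ≤ k) (H : ℕ → ℕ → M) :
    ∏ j ∈ range n, H (j % k) (j / k) =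
      ∏ t ∈ range k, ∏ c ∈ range (n / k + if t < n % k then 1 else 0), H t c := by
  rw [Finset.prod_sigma']
  refine Finset.prod_nbij' (fun j => ⟨j % k, j / k⟩) (fun p => p.2 * k + p.1) ?_ ?_ ?_ ?_ ?_
  · intro j hj
    simp only [mem_sigma, mem_range] at *
    exact ⟨Nat.mod_lt _ hk, (aux_div_lt hk).1 hj⟩
  · rintro ⟨t, c⟩ hp
    simp only [mem_sigma, mem_range] at *
    rw [aux_div_lt hk, aux_mk_mod hp.1, aux_mk_div hp.1]
    exact hp.2
  · intro j hj
    exact Nat.div_add_mod' j k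
  · rintro ⟨t, c⟩ hp
    simp only [mem_sigma, mem_range] at *
    simp [aux_mk_mod hp.1, aux_mk_div hp.1]
  · intro j hj
    rfl

lemma aux_fiber (n k t : ℕ) (hk : 1 ≤ k) (ht : t < k) :
    ((univ : Finset (Fin n)).filter fun i => i.val % k = t).card
      = n / k + if t < n % k then 1 else 0 := by
  refine (Finset.card_bij' (t := range (n / k + if t < n % k then 1 else 0))
    (fun i _ => i.val / k) (fun c hc => ⟨c * k + t, by
      rw [aux_div_lt hk, aux_mk_mod ht, aux_mk_div ht]; simpa using hc⟩) ?_ ?_ ?_ ?_).trans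
      (card_range _)
  · intro i hi
    simp only [mem_filter, mem_univ, true_and] at hi
    have := (aux_div_lt hk).1 i.2
    rw [hi] at this
    exact mem_range.2 this
  · intro c hc
    simp [Nat.mod_eq_of_lt ht]
  · intro i hi
    simp only [mem_filter, mem_univ, true_and] at hi
    ext
    simp only [← hi]
    exact Nat.div_add_mod' _ _
  · intro c hc
    exact aux_mk_div ht

/-- earlier positions of the same class -/
lemma aux_pre (n k : ℕ) (hk : 1 ≤ k) (j : Fin n) :
    ((univ : Finset (Fin n)).filter fun i => i < j ∧ i.val % k = j.val % k).card = j.val / k := by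
  have h := aux_fiber j.val k (j.val % k) hk (Nat.mod_lt _ hk)
  rw [if_neg (lt_irrefl _), add_zero] at h
  rw [← h]
  refine Finset.card_bij' (fun i hi => ⟨i.val, by
    simp only [mem_filter, mem_univ, true_and] at hi; exact hi.1⟩)
    (fun i _ => ⟨i.val, i.2.trans j.2⟩) ?_ ?_ ?_ ?_
  · intro i hi
    exact mem_filter.2 ⟨mem_univ _, (mem_filter.1 hi).2.2⟩
  · intro i hi
    exact mem_filter.2 ⟨mem_univ _, i.2, (mem_filter.1 hi).2⟩
  · intro i hi; rfl
  · intro i hi; rfl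

/-- number of earlier positions in the same class with smaller value -/
def acode (n k : ℕ) (σ : Equiv.Perm (Fin n)) (j : Fin n) : ℕ :=
  ((univ : Finset (Fin n)).filter fun i =>
    (i < j ∧ i.val % k = j.val % k) ∧ σ i < σ j).card

/-- number of earlier positions in the same class with larger value -/
def bcode (n k : ℕ) (σ : Equiv.Perm (Fin n)) (j : Fin n) : ℕ :=
  ((univ : Finset (Fin n)).filter fun i =>
    (i < j ∧ i.val % k = j.val % k) ∧ σ j < σ i).card

lemma acode_add_bcode (n k : ℕ) (hk : 1 ≤ k) (σ : Equiv.Perm (Fin n)) (j : Fin n) :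
    acode n k σ j + bcode n k σ j = j.val / k := by
  rw [← aux_pre n k hk j, acode, bcode,
    ← Finset.card_filter_add_card_filter_not (s := univ.filter fun i : Fin n =>
      i < j ∧ i.val % k = j.val % k) (fun i => σ i < σ j),
    filter_filter, filter_filter]
  congr 2
  apply filter_congr
  intro i _
  have : i < j → σ i ≠ σ j := fun h h' => h.ne (σ.injective h')
  constructor
  · rintro ⟨h, h'⟩; exact ⟨h, by exact not_lt.2 h'.le⟩
  · rintro ⟨h, h'⟩; exact ⟨h, lt_of_le_of_ne (not_lt.1 h') (this h.1).symm⟩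

lemma acode_order (n k : ℕ) (τ τ' : Equiv.Perm (Fin n)) (h : acode n k τ = acode n k τ') :
    ∀ m : ℕ, ∀ i j : Fin n, j.val < m → i < j → i.val % k = j.val % k →
      (τ i < τ j ↔ τ' i < τ' j) := by
  intro m
  induction m with
  | zero => intro i j hj; omega
  | succ m ih =>
    intro i j hj hij hc
    have hcard := congrFun h j
    unfold acode at hcard
    set A := (univ : Finset (Fin n)).filter fun i =>
      (i < j ∧ i.val % k = j.val % k) ∧ τ i < τ j with hA
    set A' := (univ : Finset (Fin n)).filter fun i =>
      (i < j ∧ i.val % k = j.val % k) ∧ τ' i < τ' j with hA'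
    have hsub : A ⊆ A' ∨ A' ⊆ A := by
      by_contra hcon
      push Not at hcon
      obtain ⟨h1, h2⟩ := hcon
      rw [Finset.not_subset] at h1 h2
      obtain ⟨u, hu, hu'⟩ := h1
      obtain ⟨v, hv, hv'⟩ := h2
      simp only [hA, hA', mem_filter, mem_univ, true_and] at hu hu' hv hv'
      have e1 : τ v ≠ τ j := fun h' => hv.1.1.ne (τ.injective h')
      have e2 : τ' u ≠ τ' j := fun h' => hu.1.1.ne (τ'.injective h')
      have h3 : τ' j < τ' u := lt_of_le_of_ne (not_lt.1 fun hh => hu' ⟨hu.1, hh⟩) e2.symm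
      have h4 : τ j < τ v := lt_of_le_of_ne (not_lt.1 fun hh => hv' ⟨hv.1, hh⟩) e1.symm
      have h5 : τ u < τ v := hu.2.trans h4
      have h6 : τ' v < τ' u := hv.2.trans h3
      rcases lt_trichotomy u v with huv | huv | huv
      · have := (ih u v (by have := hv.1.1; omega) huv (hu.1.2.trans hv.1.2.symm)).1 h5
        exact absurd this h6.not_gt
      · subst huv; exact absurd h5 (lt_irrefl _)
      · have := (ih v u (by have := hu.1.1; omega) huv (hv.1.2.trans hu.1.2.symm)).2 h6
        exact absurd this h5.not_gt
    have hAA : A = A' := by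
      rcases hsub with hs | hs
      · exact eq_of_subset_of_card_le hs hcard.ge
      · exact (eq_of_subset_of_card_le hs hcard.le).symm
    have := Finset.ext_iff.1 hAA i
    simp only [hA, hA', mem_filter, mem_univ, true_and] at this
    constructor
    · intro hh; exact (this.1 ⟨⟨hij, hc⟩, hh⟩).2
    · intro hh; exact (this.2 ⟨⟨hij, hc⟩, hh⟩).2

lemma acode_order' (n k : ℕ) (τ τ' : Equiv.Perm (Fin n)) (h : acode n k τ = acode n k τ')
    (i j : Fin n) (hc : i.val % k = j.val % k) : τ i < τ j ↔ τ' i < τ' j := by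
  rcases lt_trichotomy i j with hij | hij | hij
  · exact acode_order n k τ τ' h _ i j (Nat.lt_succ_self _) hij hc
  · subst hij; simp
  · have := acode_order n k τ τ' h _ j i (Nat.lt_succ_self _) hij hc.symm
    have e1 : τ i ≠ τ j := fun h' => hij.ne' (τ.injective h')
    have e2 : τ' i ≠ τ' j := fun h' => hij.ne' (τ'.injective h')
    rw [← not_iff_not, not_lt, not_lt, le_iff_lt_or_eq, le_iff_lt_or_eq, this]
    simp [e1.symm, e2.symm]

/-- rank inside the class -/
def crank (n k : ℕ) (σ : Equiv.Perm (Fin n)) (x : Fin n) : ℕ :=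
  ((univ : Finset (Fin n)).filter fun y => y.val % k = x.val % k ∧ σ y < σ x).card

lemma crank_lt (n k : ℕ) (σ : Equiv.Perm (Fin n)) (x y : Fin n) (hc : x.val % k = y.val % k)
    (h : σ x < σ y) : crank n k σ x < crank n k σ y := by
  apply Finset.card_lt_card
  rw [Finset.ssubset_iff_of_subset]
  · exact ⟨x, by simp [hc, h], by simp⟩
  · intro z
    simp only [mem_filter, mem_univ, true_and]
    rintro ⟨h1, h2⟩
    exact ⟨h1.trans hc, h2.trans h⟩

lemma crank_inj (n k : ℕ) (σ : Equiv.Perm (Fin n)) (x y : Fin n) (hc : x.val % k = y.val % k)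
    (h : crank n k σ x = crank n k σ y) : x = y := by
  rcases lt_trichotomy (σ x) (σ y) with hh | hh | hh
  · exact absurd h (crank_lt n k σ x y hc hh).ne
  · exact σ.injective hh
  · exact absurd h (crank_lt n k σ y x hc.symm hh).ne'

lemma crank_comp (n k : ℕ) (σ g : Equiv.Perm (Fin n)) (hg : ∀ i, (g i).val % k = i.val % k)
    (i : Fin n) : crank n k σ (g i) = crank n k (σ * g) i := by
  symm
  refine Finset.card_bij' (fun y _ => g y) (fun y _ => g.symm y) ?_ ?_ ?_ ?_
  · intro y hy
    have hy := (mem_filter.1 hy).2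
    refine mem_filter.2 ⟨mem_univ _, ?_⟩
    rw [hg, hg]; exact hy
  · intro y hy
    have hy := (mem_filter.1 hy).2
    refine mem_filter.2 ⟨mem_univ _, ?_⟩
    have := hg (g.symm y)
    rw [Equiv.Perm.mul_apply, Equiv.Perm.mul_apply]
    rw [Equiv.apply_symm_apply] at this ⊢
    rw [← this, ← hg i]; exact hy
  · intro y hy; simp
  · intro y hy; simp

lemma acode_inj (n k : ℕ) (σ g g' : Equiv.Perm (Fin n)) (hg : ∀ i, (g i).val % k = i.val % k)
    (hg' : ∀ i, (g' i).val % k = i.val % k)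
    (h : acode n k (σ * g) = acode n k (σ * g')) : g = g' := by
  ext i
  congr 1
  apply crank_inj n k σ _ _ ((hg i).trans (hg' i).symm)
  rw [crank_comp n k σ g hg, crank_comp n k σ g' hg']
  unfold crank
  congr 1
  apply filter_congr
  intro y _
  constructor
  · rintro ⟨h1, h2⟩; exact ⟨h1, (acode_order' n k _ _ h _ _ h1).1 h2⟩
  · rintro ⟨h1, h2⟩; exact ⟨h1, (acode_order' n k _ _ h _ _ h1).2 h2⟩

lemma aux_split {M : Type*} [CommMonoid M] (r k : ℕ) (A B : M) (h : r ≤ k) :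
    ∏ t ∈ range k, (if t < r then A else B) = A ^ r * B ^ (k - r) := by
  obtain ⟨s, rfl⟩ : ∃ s, k = r + s := ⟨k - r, by omega⟩
  rw [Finset.prod_range_add, Nat.add_sub_cancel_left]
  congr 1
  · rw [Finset.prod_congr rfl (g := fun _ => A), Finset.prod_const, card_range]
    intro i hi
    rw [if_pos (mem_range.1 hi)]
  · rw [Finset.prod_congr rfl (g := fun _ => B), Finset.prod_const, card_range]
    intro i hi
    rw [if_neg (by omega)]

lemma card_G (n k : ℕ) (hk : 1 ≤ k) :
    Fintype.card {g : Equiv.Perm (Fin n) // ∀ i, (g i).val % k = i.val % k} =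
      (n / k + 1).factorial ^ (n % k) * (n / k).factorial ^ (k - n % k) := by
  have h := DomMulAct.stabilizer_card (fun i : Fin n => (⟨i.val % k, Nat.mod_lt _ hk⟩ : Fin k))
  have e : Fintype.card {g : Equiv.Perm (Fin n) // ∀ i, (g i).val % k = i.val % k} =
    Fintype.card {g : Equiv.Perm (Fin n) //
      (fun i : Fin n => (⟨i.val % k, Nat.mod_lt _ hk⟩ : Fin k)) ∘ g = 
        (fun i : Fin n => (⟨i.val % k, Nat.mod_lt _ hk⟩ : Fin k))} := by
    apply Fintype.card_congr
    apply Equiv.subtypeEquivRight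
    intro g
    simp [funext_iff]
  rw [e, h]
  have : ∀ t : Fin k, (Fintype.card {a : Fin n // (⟨a.val % k, Nat.mod_lt _ hk⟩ : Fin k) = t}) =
      n / k + if t.val < n % k then 1 else 0 := by
    intro t
    rw [← aux_fiber n k t hk t.2, Fintype.card_subtype]
    simp [Fin.ext_iff]
  simp only [this]
  rw [Finset.prod_fin_eq_prod_range]
  rw [← aux_split _ _ _ _ (Nat.mod_lt n hk).le]
  apply Finset.prod_congr rfl
  intro i hi
  rw [mem_range] at hi
  rw [dif_pos hi]
  split_ifs <;> rfl

lemma card_T (n k : ℕ) (hk : 1 ≤ k) :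
    (Fintype.piFinset (fun j : Fin n => range (j.val / k + 1))).card =
      (n / k + 1).factorial ^ (n % k) * (n / k).factorial ^ (k - n % k) := by
  rw [Fintype.card_piFinset]
  simp only [card_range]
  rw [Fin.prod_univ_eq_prod_range (fun j => j / k + 1),
    aux_prod n k hk (fun _ c => c + 1), ← aux_split _ _ _ _ (Nat.mod_lt n hk).le]
  apply Finset.prod_congr rfl
  intro i hi
  rw [Finset.prod_range_add_one_eq_factorial]
  split_ifs <;> rfl

lemma acode_mem (n k : ℕ) (hk : 1 ≤ k) (σ : Equiv.Perm (Fin n)) :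
    acode n k σ ∈ Fintype.piFinset (fun j : Fin n => range (j.val / k + 1)) := by
  rw [Fintype.mem_piFinset]
  intro j
  have := acode_add_bcode n k hk σ j
  rw [mem_range]
  omega

lemma acode_image (n k : ℕ) (hk : 1 ≤ k) (σ : Equiv.Perm (Fin n)) :
    (univ.image fun g : {g : Equiv.Perm (Fin n) // ∀ i, (g i).val % k = i.val % k} =>
      acode n k (σ * g.1)) = Fintype.piFinset (fun j : Fin n => range (j.val / k + 1)) := by
  apply eq_of_subset_of_card_le
  · intro v hv
    obtain ⟨g, _, rfl⟩ := mem_image.1 hv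
    exact acode_mem n k hk _
  · rw [Finset.card_image_of_injective, card_T n k hk, ← card_G n k hk]
    · exact le_rfl
    · intro g g' h
      exact Subtype.ext (acode_inj n k σ g.1 g'.1 g.2 g'.2 h)

lemma acode_count (n k : ℕ) (hk : 1 ≤ k) (v : Fin n → ℕ)
    (hv : v ∈ Fintype.piFinset (fun j : Fin n => range (j.val / k + 1))) :
    (univ.filter fun σ : Equiv.Perm (Fin n) => acode n k σ = v).card = Mnk n k := by
  have key : (univ.filter fun σ : Equiv.Perm (Fin n) => acode n k σ = v).card *
      Fintype.card {g : Equiv.Perm (Fin n) // ∀ i, (g i).val % k = i.val % k} = n.factorial := by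
    have h1 : ∀ g : {g : Equiv.Perm (Fin n) // ∀ i, (g i).val % k = i.val % k},
        (∑ σ : Equiv.Perm (Fin n), if acode n k (σ * g.1) = v then 1 else 0) =
        (univ.filter fun σ : Equiv.Perm (Fin n) => acode n k σ = v).card := by
      intro g
      rw [Finset.card_filter]
      exact Fintype.sum_equiv (Equiv.mulRight g.1) _ _ (fun σ => rfl)
    have h2 : ∀ σ : Equiv.Perm (Fin n),
        (∑ g : {g : Equiv.Perm (Fin n) // ∀ i, (g i).val % k = i.val % k},
          if acode n k (σ * g.1) = v then 1 else 0) = 1 := by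
      intro σ
      rw [← acode_image n k hk σ] at hv
      obtain ⟨g, _, rfl⟩ := mem_image.1 hv
      rw [Finset.sum_eq_single g]
      · simp
      · intro g' _ hne
        rw [if_neg]
        intro h
        exact hne (Subtype.ext (acode_inj n k σ g'.1 g.1 g'.2 g.2 h))
      · intro h; exact absurd (mem_univ _) h
    calc _ = ∑ g : {g : Equiv.Perm (Fin n) // ∀ i, (g i).val % k = i.val % k},
          ∑ σ : Equiv.Perm (Fin n), if acode n k (σ * g.1) = v then 1 else 0 := by
            simp only [h1]
            rw [Finset.sum_const, smul_eq_mul, mul_comm]; rfl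
      _ = ∑ σ : Equiv.Perm (Fin n), 1 := by
            rw [Finset.sum_comm]
            exact Finset.sum_congr rfl (fun σ _ => h2 σ)
      _ = n.factorial := by simp [Fintype.card_perm]
  rw [Mnk, ← card_G n k hk, ← key, Nat.mul_div_cancel]
  rw [card_G n k hk]
  positivity

lemma sum_acode {R : Type*} [CommRing R] (n k : ℕ) (hk : 1 ≤ k) (f : Fin n → ℕ → R) :
    ∑ σ : Equiv.Perm (Fin n), ∏ j, f j (acode n k σ j) =
      (Mnk n k : R) * ∏ j : Fin n, ∑ a ∈ range (j.val / k + 1), f j a := by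
  rw [Finset.prod_univ_sum, ← Finset.sum_fiberwise_of_maps_to
    (t := Fintype.piFinset (fun j : Fin n => range (j.val / k + 1)))
    (g := fun σ => acode n k σ) (fun σ _ => acode_mem n k hk σ), Finset.mul_sum]
  apply Finset.sum_congr rfl
  intro v hv
  rw [Finset.sum_congr rfl (g := fun _ => ∏ j, f j (v j)), Finset.sum_const, acode_count n k hk v hv,
    nsmul_eq_mul]
  intro σ hσ
  rw [(mem_filter.1 hσ).2]

lemma qsum_one {R : Type*} [CommRing R] (x : R) (c : ℕ) :
    ∑ a ∈ range (c + 1), (x ^ (c - a) + x ^ (c + a + 1)) = ∑ j ∈ range (2 * (c + 1)), x ^ j := by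
  rw [Finset.sum_add_distrib, two_mul, Finset.sum_range_add (fun j => x ^ j) (c + 1) (c + 1),
    ← Finset.sum_range_reflect (fun j => x ^ j) (c + 1)]
  congr 1
  apply Finset.sum_congr rfl
  intro a _
  congr 1
  omega

lemma qsum_zero {R : Type*} [CommRing R] (x : R) (c : ℕ) :
    ∑ a ∈ range (c + 1), (x ^ (c - a) + x ^ (c + a)) = (∑ j ∈ range (c + 1), x ^ j) * (1 + x ^ c) := by
  rw [Finset.sum_add_distrib, mul_add, mul_one,
    ← Finset.sum_range_reflect (fun j => x ^ j) (c + 1)]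
  congr 1
  rw [Finset.sum_range_reflect (fun j => x ^ j) (c + 1), Finset.sum_mul]
  apply Finset.sum_congr rfl
  intro a _
  rw [pow_add, mul_comm]

lemma qprod_one {R : Type*} [CommRing R] (x : R) (m : ℕ) :
    ∏ c ∈ range m, ∑ a ∈ range (c + 1), (x ^ (c - a) + x ^ (c + a + 1)) =
      ∏ i ∈ Icc 1 m, ∑ j ∈ range (2 * i), x ^ j := by
  induction m with
  | zero => simp
  | succ m ih => rw [Finset.prod_range_succ, ih, qsum_one, Finset.prod_Icc_succ_top (by omega)]

lemma qprod_zero {R : Type*} [CommRing R] (x : R) (m : ℕ) :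
    ∏ c ∈ range (m + 1), ∑ a ∈ range (c + 1), (x ^ (c - a) + x ^ (c + a)) =
      2 * (∑ j ∈ range (m + 1), x ^ j) * ∏ i ∈ Icc 1 m, ∑ j ∈ range (2 * i), x ^ j := by
  induction m with
  | zero => norm_num
  | succ m ih =>
    rw [Finset.prod_range_succ, ih, qsum_zero, Finset.prod_Icc_succ_top (by omega)]
    have : ∑ j ∈ range (2 * (m + 1)), x ^ j = (∑ j ∈ range (m + 1), x ^ j) * (1 + x ^ (m + 1)) := by
      rw [two_mul, Finset.sum_range_add, mul_add, mul_one, Finset.sum_mul]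
      congr 1
      apply Finset.sum_congr rfl
      intro a _
      rw [pow_add, mul_comm]
    rw [this]
    ring

lemma final_prod {R : Type*} [CommRing R] (n k : ℕ) (hk : 1 ≤ k) (hkn : k ≤ n) (x : R) :
    ∏ j : Fin n, ∑ a ∈ range (j.val / k + 1),
        (x ^ (j.val / k - a) + x ^ (j.val / k + a + if j.val % k = k - 1 then 1 else 0)) =
      2 ^ (k - 1) *
        (∑ i ∈ Finset.range (n / k), x ^ i) ^ (k - n % k - 1) *
        (∑ i ∈ Finset.range (n / k + 1), x ^ i) ^ (n % k) *
        (∏ i ∈ Finset.Icc 1 (n / k), ∑ j ∈ Finset.range (2 * i), x ^ j) ^ (n % k + 1) *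
        (∏ i ∈ Finset.Icc 1 (n / k - 1), ∑ j ∈ Finset.range (2 * i), x ^ j) ^ (k - n % k - 1) := by
  rw [Fin.prod_univ_eq_prod_range (fun j => ∑ a ∈ range (j / k + 1),
        (x ^ (j / k - a) + x ^ (j / k + a + if j % k = k - 1 then 1 else 0))),
    aux_prod n k hk (fun t c => ∑ a ∈ range (c + 1),
        (x ^ (c - a) + x ^ (c + a + if t = k - 1 then 1 else 0)))]
  have hd : 1 ≤ n / k := Nat.div_pos hkn hk
  have hr := Nat.mod_lt n hk
  generalize n / k = d at *
  generalize n % k = r at *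
  obtain ⟨d, rfl⟩ : ∃ e, d = e + 1 := ⟨d - 1, by omega⟩
  obtain ⟨s, rfl⟩ : ∃ s, k = r + s + 1 := ⟨k - r - 1, by omega⟩
  rw [Finset.prod_range_succ, if_neg (by omega)]
  have e1 : r + s + 1 - 1 = r + s := rfl
  have e2 : r + s + 1 - r - 1 = s := by omega
  simp only [e1, e2, if_true, add_zero, Nat.add_sub_cancel]
  rw [qprod_one]
  rw [Finset.prod_congr rfl (g := fun t => if t < r then 
    2 * (∑ j ∈ range (d + 1 + 1), x ^ j) * ∏ i ∈ Icc 1 (d + 1), ∑ j ∈ range (2 * i), x ^ j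
    else 2 * (∑ j ∈ range (d + 1), x ^ j) * ∏ i ∈ Icc 1 d, ∑ j ∈ range (2 * i), x ^ j)]
  · rw [aux_split _ _ _ _ (by omega), Nat.add_sub_cancel_left]
    simp only [mul_pow, pow_add, pow_one]
    ring
  · intro t ht
    rw [mem_range] at ht
    have ht' : t ≠ r + s := ht.ne
    simp only [if_neg ht', add_zero]
    split_ifs
    · rw [qprod_zero]
    · rw [add_zero, qprod_zero]

lemma sum_Icc_fin (n : ℕ) (f : ℕ → ℕ) : ∑ p ∈ Icc 1 n, f p = ∑ i : Fin n, f (i.val + 1) := by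
  rw [Fin.sum_univ_eq_sum_range (fun i => f (i + 1)), Finset.range_eq_Ico,
    Finset.sum_Ico_add' f 0 n 1]
  rfl

lemma pairs_sum (n k : ℕ) (P : ℕ → ℕ → Prop) [∀ a b, Decidable (P a b)] :
    (((Icc 1 n) ×ˢ (Icc 1 n)).filter fun p : ℕ × ℕ =>
      p.1 < p.2 ∧ k ∣ (p.2 - p.1) ∧ P p.1 p.2).card =
    ∑ j : Fin n, ((univ.filter fun i : Fin n => i < j ∧ i.val % k = j.val % k).filter
      fun i => P (i.val + 1) (j.val + 1)).card := by
  rw [Finset.card_filter, Finset.sum_product_right, sum_Icc_fin]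
  apply Finset.sum_congr rfl
  intro j _
  rw [sum_Icc_fin n (fun a => if a < j.val + 1 ∧ k ∣ (j.val + 1 - a) ∧ P a (j.val + 1) then 1 else 0),
    filter_filter, Finset.card_filter]
  apply Finset.sum_congr rfl
  intro i _
  congr 1
  rw [eq_iff_iff, and_assoc, Nat.add_lt_add_iff_right, Nat.add_sub_add_right, Fin.lt_def]
  apply and_congr_right
  intro h
  rw [← Nat.modEq_iff_dvd' h.le]
  rfl

lemma bval_succ (n : ℕ) (σ : Equiv.Perm (Fin n)) (ε : Fin n → Bool) (j : Fin n) :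
    bval n σ ε ((j.val + 1 : ℕ) : ℤ) =
      if ε j then -((((σ j : Fin n) : ℕ) : ℤ) + 1) else (((σ j : Fin n) : ℕ) : ℤ) + 1 := by
  have h : 1 ≤ (((j.val + 1 : ℕ) : ℤ)).natAbs ∧ (((j.val + 1 : ℕ) : ℤ)).natAbs ≤ n := by
    rw [Int.natAbs_natCast]; omega
  have hs : Int.sign ((j.val + 1 : ℕ) : ℤ) = 1 := Int.sign_eq_one_of_pos (by omega)
  unfold bval
  rw [dif_pos h, hs, one_mul]
  rfl

lemma negk_eq (n k : ℕ) (hk : 1 ≤ k) (σ : Equiv.Perm (Fin n)) (ε : Fin n → Bool) :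
    negk n k (bval n σ ε) =
      ∑ j : Fin n, if ε j then (if j.val % k = k - 1 then 1 else 0) else 0 := by
  have h0 : (∑ j : Fin n, if ε j then (if j.val % k = k - 1 then 1 else 0) else 0) =
      (univ.filter fun j : Fin n => j.val % k = k - 1 ∧ ε j = true).card := by
    rw [Finset.card_filter]
    apply Finset.sum_congr rfl
    intro j _
    by_cases h1 : j.val % k = k - 1 <;> by_cases h2 : ε j = true <;> simp [h1, h2]
  rw [h0, negk]
  have hneg : ∀ j : Fin n, bval n σ ε ((j.val + 1 : ℕ) : ℤ) < 0 ↔ ε j = true := by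
    intro j
    rw [bval_succ]
    split_ifs with h
    · simp only [h, iff_true]; omega
    · simp only [h]; constructor
      · intro; omega
      · intro h'; exact absurd h' (by simp)
  have hval : ∀ i, 1 ≤ i → i * k - 1 = (i - 1) * k + (k - 1) := by
    intro i hi
    obtain ⟨c, rfl⟩ : ∃ c, i = c + 1 := ⟨i - 1, by omega⟩
    rw [Nat.add_sub_cancel, Nat.add_mul]; omega
  have hlt : ∀ i, i ∈ Icc 1 (n / k) → i * k - 1 < n := by
    intro i hi
    rw [mem_Icc] at hi
    have h1 := (Nat.le_div_iff_mul_le hk).1 hi.2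
    have h2 : 1 * 1 ≤ i * k := Nat.mul_le_mul hi.1 hk
    omega
  refine Finset.card_bij' (fun i hi => ⟨i * k - 1, hlt i (mem_filter.1 hi).1⟩)
    (fun j _ => j.val / k + 1) ?_ ?_ ?_ ?_
  · intro i hi
    obtain ⟨hi, hb⟩ := mem_filter.1 hi
    refine mem_filter.2 ⟨mem_univ _, ?_, ?_⟩
    · show (i * k - 1) % k = k - 1
      rw [hval i (mem_Icc.1 hi).1, aux_mk_mod (by omega)]
    · rw [← hneg]
      have h2 : 1 * 1 ≤ i * k := Nat.mul_le_mul (mem_Icc.1 hi).1 hk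
      have h3 : ((i * k - 1 + 1 : ℕ) : ℤ) = (i : ℤ) * k := by
        rw [← Nat.cast_mul]
        congr 1
        omega
      show bval n σ ε ((i * k - 1 + 1 : ℕ) : ℤ) < 0
      rw [h3]
      exact hb
  · intro j hj
    obtain ⟨_, hj1, hj2⟩ := mem_filter.1 hj
    have e : (j.val / k + 1) * k = j.val + 1 := by
      have := Nat.div_add_mod' j.val k
      rw [Nat.add_mul]; omega
    refine mem_filter.2 ⟨mem_Icc.2 ⟨Nat.le_add_left 1 _, ?_⟩, ?_⟩
    · rw [Nat.le_div_iff_mul_le hk, e]; exact j.2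
    · rw [← Nat.cast_mul, e]; exact (hneg j).2 hj2
  · intro i hi
    obtain ⟨hi, hb⟩ := mem_filter.1 hi
    show (i * k - 1) / k + 1 = i
    rw [hval i (mem_Icc.1 hi).1, aux_mk_div (by omega)]
    have := (mem_Icc.1 hi).1
    omega
  · intro j hj
    obtain ⟨_, hj1, hj2⟩ := mem_filter.1 hj
    ext
    show (j.val / k + 1) * k - 1 = j.val
    have := Nat.div_add_mod' j.val k
    rw [Nat.add_mul]; omega

lemma inv_nsp_eq (n k : ℕ) (σ : Equiv.Perm (Fin n)) (ε : Fin n → Bool) :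
    invAk n k (bval n σ ε) + nspk n k (bval n σ ε) =
      ∑ j : Fin n, (bcode n k σ j + if ε j then 2 * acode n k σ j else 0) := by
  rw [invAk, nspk, pairs_sum n k (fun a b => bval n σ ε a > bval n σ ε b),
    pairs_sum n k (fun a b => bval n σ ε a + bval n σ ε b < 0), ← Finset.sum_add_distrib]
  apply Finset.sum_congr rfl
  intro j _
  have ha : acode n k σ j = ((univ.filter fun i : Fin n => i < j ∧ i.val % k = j.val % k).filter
      fun i => σ i < σ j).card := by rw [acode, filter_filter]
  have hb : bcode n k σ j = ((univ.filter fun i : Fin n => i < j ∧ i.val % k = j.val % k).filter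
      fun i => σ j < σ i).card := by rw [bcode, filter_filter]
  rw [ha, hb]
  simp only [Finset.card_filter _ (univ.filter fun i : Fin n => i < j ∧ i.val % k = j.val % k)]
  have : ∀ c : ℕ, (if ε j then 2 * c else 0) = (if ε j then 2 else 0) * c := by
    intro c; split_ifs <;> simp
  rw [this, Finset.mul_sum, ← Finset.sum_add_distrib, ← Finset.sum_add_distrib]
  apply Finset.sum_congr rfl
  intro i hi
  have hne : σ i ≠ σ j := fun h' => (mem_filter.1 hi).2.1.ne (σ.injective h')
  have hne' : (σ i).val ≠ (σ j).val := fun h => hne (Fin.ext h)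
  rw [bval_succ, bval_succ]
  simp only [Fin.lt_def]
  generalize (σ i).val = a at *
  generalize (σ j).val = b at *
  cases ε i <;> cases ε j <;> simp only [if_true, if_false, Bool.false_eq_true] <;>
    split_ifs <;> omega

lemma invBk_eq (n k : ℕ) (hk : 1 ≤ k) (σ : Equiv.Perm (Fin n)) (ε : Fin n → Bool) :
    invBk n k (bval n σ ε) = ∑ j : Fin n, (if ε j then
      j.val / k + acode n k σ j + (if j.val % k = k - 1 then 1 else 0)
      else j.val / k - acode n k σ j) := by
  have : invBk n k (bval n σ ε) =
    (invAk n k (bval n σ ε) + nspk n k (bval n σ ε)) + negk n k (bval n σ ε) := by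
    unfold invBk; omega
  rw [this, inv_nsp_eq, negk_eq n k hk, ← Finset.sum_add_distrib]
  apply Finset.sum_congr rfl
  intro j _
  have := acode_add_bcode n k hk σ j
  cases ε j <;> simp only [if_true, if_false, Bool.false_eq_true] <;> omega

lemma sum_signs {R : Type*} [CommRing R] (n k : ℕ) (hk : 1 ≤ k) (x : R)
    (σ : Equiv.Perm (Fin n)) :
    ∑ ε : Fin n → Bool, x ^ invBk n k (bval n σ ε) =
      ∏ j : Fin n, (x ^ (j.val / k - acode n k σ j) +
        x ^ (j.val / k + acode n k σ j + if j.val % k = k - 1 then 1 else 0)) := by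
  have h : ∀ j : Fin n, (x ^ (j.val / k - acode n k σ j) +
        x ^ (j.val / k + acode n k σ j + if j.val % k = k - 1 then 1 else 0)) =
      ∑ b ∈ (univ : Finset Bool), x ^ (if b then
      j.val / k + acode n k σ j + (if j.val % k = k - 1 then 1 else 0)
      else j.val / k - acode n k σ j) := by
    intro j
    rw [Fintype.sum_bool, add_comm]
    rfl
  simp only [h]
  rw [Finset.prod_univ_sum, Fintype.piFinset_univ]
  apply Finset.sum_congr rfl
  intro ε _
  rw [invBk_eq n k hk, Finset.prod_pow_eq_pow_sum]

/-- Theorem 15, Eq. (11):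
`Σ_{π ∈ B_n} x^{inv_k^B(π)} =
 2^{k-1} M_{n,k} [d]_x^{k-r-1} [d+1]_x^r ([2d]_x!!)^{r+1} ([2(d-1)]_x!!)^{k-r-1}`. -/
theorem stmt9 (n k : ℕ) (hk : 1 ≤ k) (hkn : k ≤ n) (R : Type*) [CommRing R] (x : R) :
    ∑ σ : Equiv.Perm (Fin n), ∑ ε : Fin n → Bool, x ^ invBk n k (bval n σ ε) =
      2 ^ (k - 1) * (Mnk n k : R) *
        (∑ i ∈ Finset.range (n / k), x ^ i) ^ (k - n % k - 1) *
        (∑ i ∈ Finset.range (n / k + 1), x ^ i) ^ (n % k) *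
        (∏ i ∈ Finset.Icc 1 (n / k), ∑ j ∈ Finset.range (2 * i), x ^ j) ^ (n % k + 1) *
        (∏ i ∈ Finset.Icc 1 (n / k - 1), ∑ j ∈ Finset.range (2 * i), x ^ j) ^ (k - n % k - 1) := by
  simp only [sum_signs n k hk x]
  rw [sum_acode n k hk (fun j a => x ^ (j.val / k - a) +
    x ^ (j.val / k + a + if j.val % k = k - 1 then 1 else 0)), final_prod n k hk hkn x]
  ring
end
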